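/- On the quotient of ker Q by ran Q in the one-particle sector of the massless graviton Fock space, every equivalence class has a representative (f_{μν}, g_μ = 0) with ∂^ν f_{μν} = 0 and f = η^{μν}f_{μν} = 0, and the residual freedom is f_{μν} ↦ f_{μν} − ½(∂_μ g′_ν + ∂_ν g′_μ) with ∂^μ g′_μ = 0. -/

import Mathlib

/-- Minkowski metric with signature (+,-,-,-). -/
def minkEta (μ ν : Fin 4) : ℝ :=
  if μ = ν then (if μ = 0 then 1 else -1) else 0

/-- Partial derivative in direction `μ` of a function on `ℝ⁴`. -/
noncomputable def pd (μ : Fin 4) (φ : (Fin 4 → ℝ) → ℝ) : (Fin 4 → ℝ) → ℝ :=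
  fun x => fderiv ℝ φ x (Pi.single μ 1)

/-- The wave operator `□ = η^{μν} ∂_μ ∂_ν`. -/
noncomputable def waveOp (φ : (Fin 4 → ℝ) → ℝ) : (Fin 4 → ℝ) → ℝ :=
  fun x => ∑ μ : Fin 4, minkEta μ μ * pd μ (pd μ φ) x

open scoped ContDiff

section RadialIntegral

variable {V W : Type} [NormedAddCommGroup V] [NormedSpace ℝ V]
  [NormedAddCommGroup W] [NormedSpace ℝ W]

/-- The weighted average `∫₀¹ sᵏ F(s x) ds` of `F` along the segment from `0` to `x`. -/
noncomputable def radialIntegral (k : ℕ) (F : V → W) (x : V) : W :=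
  ∫ s in (0 : ℝ)..1, s ^ k • F (s • x)

lemma continuous_radialIntegral (k : ℕ) {F : V → W} (hF : Continuous F) :
    Continuous (radialIntegral k F) := by
  apply intervalIntegral.continuous_parametric_intervalIntegral_of_continuous'
  fun_prop

lemma hasFDerivAt_radialIntegral [FiniteDimensional ℝ V] (k : ℕ) {F : V → W}
    (hF : ContDiff ℝ 1 F) (x : V) :
    HasFDerivAt (radialIntegral k F) (radialIntegral (k + 1) (fderiv ℝ F) x) x := by
  have hF' : Continuous (fderiv ℝ F) := hF.continuous_fderiv one_ne_zero
  have hcont : Continuous fun p : ℝ × V => p.1 ^ (k + 1) • fderiv ℝ F (p.1 • p.2) := by fun_prop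
  obtain ⟨C, hC⟩ := ((isCompact_Icc (a := (0 : ℝ)) (b := 1)).prod
    (isCompact_closedBall x 1)).exists_bound_of_continuousOn hcont.continuousOn
  refine intervalIntegral.hasFDerivAt_integral_of_dominated_of_fderiv_le
    (F := fun x s => s ^ k • F (s • x)) (F' := fun x s => s ^ (k + 1) • fderiv ℝ F (s • x))
    (bound := fun _ => C) (Metric.closedBall_mem_nhds x one_pos) ?_ ?_ ?_ ?_ ?_ ?_
  · refine Filter.Eventually.of_forall fun y => Continuous.aestronglyMeasurable ?_
    have := hF.continuous
    fun_prop
  · refine Continuous.intervalIntegrable ?_ _ _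
    have := hF.continuous
    fun_prop
  · have : SecondCountableTopologyEither ℝ (V →L[ℝ] W) :=
      secondCountableTopologyEither_of_left ℝ _
    refine Continuous.aestronglyMeasurable ?_
    fun_prop
  · refine Filter.Eventually.of_forall fun s hs y hy => hC (s, y) ⟨?_, hy⟩
    rw [Set.uIoc_of_le zero_le_one] at hs
    exact ⟨hs.1.le, hs.2⟩
  · exact intervalIntegrable_const
  · refine Filter.Eventually.of_forall fun s _ y _ => ?_
    have h1 : HasFDerivAt (fun y : V => s • y) (s • ContinuousLinearMap.id ℝ V) y :=
      (hasFDerivAt_id y).const_smul s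
    have h2 := (((hF.differentiable one_ne_zero) (s • y)).hasFDerivAt.comp y h1).const_smul (s ^ k)
    refine h2.congr_fderiv ?_
    ext v
    simp [pow_succ, mul_smul]

lemma contDiff_nat_radialIntegral [FiniteDimensional ℝ V] (n k : ℕ) {F : V → W}
    (hF : ContDiff ℝ n F) : ContDiff ℝ n (radialIntegral k F) := by
  induction n generalizing k W with
  | zero => exact contDiff_zero.2 (continuous_radialIntegral k hF.continuous)
  | succ n ih =>
    have hF1 : ContDiff ℝ 1 F := hF.of_le (by norm_cast; omega)
    have hd := hasFDerivAt_radialIntegral k hF1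
    push_cast at hF ⊢
    rw [contDiff_succ_iff_fderiv] at hF ⊢
    refine ⟨fun x => (hd x).differentiableAt, by simp, ?_⟩
    rw [funext fun x => (hd x).fderiv]
    exact ih (k + 1) hF.2.2

lemma contDiff_radialIntegral [FiniteDimensional ℝ V] (k : ℕ) {F : V → W}
    (hF : ContDiff ℝ ∞ F) : ContDiff ℝ ∞ (radialIntegral k F) :=
  contDiff_infty.2 fun n => contDiff_nat_radialIntegral n k (contDiff_infty.1 hF n)

end RadialIntegral

section PartialDerivatives

variable {φ ψ : (Fin 4 → ℝ) → ℝ}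

lemma contDiff_pd (μ : Fin 4) (hφ : ContDiff ℝ ∞ φ) : ContDiff ℝ ∞ (pd μ φ) :=
  (hφ.fderiv_right (m := ∞) (by simp)).clm_apply contDiff_const

lemma pd_add (μ : Fin 4) (hφ : ContDiff ℝ ∞ φ) (hψ : ContDiff ℝ ∞ ψ) :
    pd μ (fun x => φ x + ψ x) = fun x => pd μ φ x + pd μ ψ x := by
  ext x
  simp [pd, fderiv_fun_add (hφ.differentiable (by simp) x) (hψ.differentiable (by simp) x)]

lemma pd_sub (μ : Fin 4) (hφ : ContDiff ℝ ∞ φ) (hψ : ContDiff ℝ ∞ ψ) :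
    pd μ (fun x => φ x - ψ x) = fun x => pd μ φ x - pd μ ψ x := by
  ext x
  simp [pd, fderiv_fun_sub (hφ.differentiable (by simp) x) (hψ.differentiable (by simp) x)]

lemma pd_mul (μ : Fin 4) (hφ : ContDiff ℝ ∞ φ) (hψ : ContDiff ℝ ∞ ψ) :
    pd μ (fun x => φ x * ψ x) = fun x => φ x * pd μ ψ x + ψ x * pd μ φ x := by
  ext x
  simp [pd, fderiv_fun_mul (hφ.differentiable (by simp) x) (hψ.differentiable (by simp) x)]

lemma pd_const (μ : Fin 4) (c : ℝ) : pd μ (fun _ => c) = fun _ => 0 := by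
  ext x
  simp [pd]

lemma pd_const_mul (μ : Fin 4) (c : ℝ) (hφ : ContDiff ℝ ∞ φ) :
    pd μ (fun x => c * φ x) = fun x => c * pd μ φ x := by
  rw [pd_mul μ contDiff_const hφ, pd_const]
  simp

lemma pd_sum (μ : Fin 4) {φ : Fin 4 → (Fin 4 → ℝ) → ℝ} (hφ : ∀ ν, ContDiff ℝ ∞ (φ ν)) :
    pd μ (fun x => ∑ ν, φ ν x) = fun x => ∑ ν, pd μ (φ ν) x := by
  ext x
  simp [pd, fderiv_fun_sum fun ν _ => (hφ ν).differentiable (by simp) x]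

lemma pd_coord (μ ν : Fin 4) : pd μ (fun x => x ν) = fun _ => if ν = μ then 1 else 0 := by
  ext x
  have h : fderiv ℝ (fun x : Fin 4 → ℝ => x ν) x = ContinuousLinearMap.proj ν :=
    (ContinuousLinearMap.proj (R := ℝ) (φ := fun _ : Fin 4 => ℝ) ν).fderiv
  simp [pd, h, Pi.single_apply]

lemma pd_comm (μ ν : Fin 4) (hφ : ContDiff ℝ ∞ φ) : pd μ (pd ν φ) = pd ν (pd μ φ) := by
  ext x
  have hd : DifferentiableAt ℝ (fderiv ℝ φ) x :=
    (hφ.fderiv_right (m := ∞) (by simp)).differentiable (by simp) x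
  have h (μ ν : Fin 4) : pd μ (pd ν φ) x =
      fderiv ℝ (fderiv ℝ φ) x (Pi.single μ 1) (Pi.single ν 1) := by
    unfold pd
    rw [fderiv_clm_apply hd (differentiableAt_const _)]
    simp
  rw [h, h]
  exact (hφ.contDiffAt.isSymmSndFDerivAt (by
    simpa using WithTop.coe_le_coe.2 (le_top : (2 : ℕ∞) ≤ ⊤))) _ _

lemma contDiff_coord (μ : Fin 4) : ContDiff ℝ ∞ fun x : Fin 4 → ℝ => x μ :=
  contDiff_apply ℝ ℝ μ

lemma pd_radialIntegral (μ : Fin 4) (k : ℕ) (hφ : ContDiff ℝ ∞ φ) :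
    pd μ (radialIntegral k φ) = radialIntegral (k + 1) (pd μ φ) := by
  ext x
  have h1 : ContDiff ℝ 1 φ := hφ.of_le (by exact_mod_cast le_top)
  have hc : Continuous (fderiv ℝ φ) := h1.continuous_fderiv one_ne_zero
  rw [pd, (hasFDerivAt_radialIntegral k h1 x).fderiv, radialIntegral,
    ContinuousLinearMap.intervalIntegral_apply]
  · rfl
  · refine Continuous.intervalIntegrable ?_ _ _
    fun_prop

end PartialDerivatives

section WaveOperator

variable {φ ψ : (Fin 4 → ℝ) → ℝ}

lemma waveOp_sub (hφ : ContDiff ℝ ∞ φ) (hψ : ContDiff ℝ ∞ ψ) (x : Fin 4 → ℝ) :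
    waveOp (fun x => φ x - ψ x) x = waveOp φ x - waveOp ψ x := by
  simp only [waveOp, pd_sub _ hφ hψ, pd_sub _ (contDiff_pd _ hφ) (contDiff_pd _ hψ), mul_sub,
    Finset.sum_sub_distrib]

lemma waveOp_add (hφ : ContDiff ℝ ∞ φ) (hψ : ContDiff ℝ ∞ ψ) (x : Fin 4 → ℝ) :
    waveOp (fun x => φ x + ψ x) x = waveOp φ x + waveOp ψ x := by
  simp only [waveOp, pd_add _ hφ hψ, pd_add _ (contDiff_pd _ hφ) (contDiff_pd _ hψ), mul_add,
    Finset.sum_add_distrib]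

lemma waveOp_mul (hφ : ContDiff ℝ ∞ φ) (hψ : ContDiff ℝ ∞ ψ) (x : Fin 4 → ℝ) :
    waveOp (fun x => φ x * ψ x) x = φ x * waveOp ψ x + ψ x * waveOp φ x +
      2 * ∑ μ, minkEta μ μ * (pd μ φ x * pd μ ψ x) := by
  simp only [waveOp, pd_mul _ hφ hψ,
    pd_add _ (hφ.mul (contDiff_pd _ hψ)) (hψ.mul (contDiff_pd _ hφ)),
    pd_mul _ hφ (contDiff_pd _ hψ), pd_mul _ hψ (contDiff_pd _ hφ), Finset.mul_sum,
    ← Finset.sum_add_distrib]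
  exact Finset.sum_congr rfl fun μ _ => by ring

lemma waveOp_const_mul (c : ℝ) (hφ : ContDiff ℝ ∞ φ) (x : Fin 4 → ℝ) :
    waveOp (fun x => c * φ x) x = c * waveOp φ x := by
  simp only [waveOp, pd_const_mul _ _ hφ, pd_const_mul _ _ (contDiff_pd _ hφ), Finset.mul_sum]
  exact Finset.sum_congr rfl fun μ _ => by ring

lemma waveOp_sum {φ : Fin 4 → (Fin 4 → ℝ) → ℝ} (hφ : ∀ ν, ContDiff ℝ ∞ (φ ν))
    (x : Fin 4 → ℝ) : waveOp (fun x => ∑ ν, φ ν x) x = ∑ ν, waveOp (φ ν) x := by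
  simp only [waveOp, pd_sum _ hφ, pd_sum _ fun ν => contDiff_pd _ (hφ ν), Finset.mul_sum]
  exact Finset.sum_comm

lemma waveOp_coord (μ : Fin 4) (x : Fin 4 → ℝ) : waveOp (fun x => x μ) x = 0 := by
  simp [waveOp, pd_coord, pd_const]

lemma waveOp_pd (μ : Fin 4) (hφ : ContDiff ℝ ∞ φ) (x : Fin 4 → ℝ) :
    waveOp (pd μ φ) x = pd μ (waveOp φ) x := by
  have h (ν : Fin 4) : ContDiff ℝ ∞ (pd ν (pd ν φ)) := contDiff_pd _ (contDiff_pd _ hφ)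
  unfold waveOp
  rw [pd_sum μ fun ν => contDiff_const.mul (h ν)]
  refine Finset.sum_congr rfl fun ν _ => ?_
  rw [pd_const_mul _ _ (h ν), pd_comm ν μ hφ, pd_comm ν μ (contDiff_pd _ hφ)]

lemma waveOp_pd_eq_zero (μ : Fin 4) (hφ : ContDiff ℝ ∞ φ) (hw : ∀ x, waveOp φ x = 0)
    (x : Fin 4 → ℝ) : waveOp (pd μ φ) x = 0 := by
  rw [waveOp_pd μ hφ, funext hw, pd_const]

lemma waveOp_radialIntegral (k : ℕ) (hφ : ContDiff ℝ ∞ φ) (hw : ∀ x, waveOp φ x = 0)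
    (x : Fin 4 → ℝ) : waveOp (radialIntegral k φ) x = 0 := by
  have hc (μ : Fin 4) : Continuous (pd μ (pd μ φ)) :=
    (contDiff_pd _ (contDiff_pd _ hφ)).continuous
  simp only [waveOp, pd_radialIntegral _ _ hφ, pd_radialIntegral _ _ (contDiff_pd _ hφ),
    radialIntegral, ← intervalIntegral.integral_const_mul]
  rw [← intervalIntegral.integral_finsetSum
    fun μ _ => Continuous.intervalIntegrable (by have := hc μ; fun_prop) _ _]
  have (s : ℝ) : ∑ μ, minkEta μ μ * s ^ (k + 1 + 1) • pd μ (pd μ φ) (s • x) = 0 := by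
    have := congrArg (s ^ (k + 1 + 1) * ·) (hw (s • x))
    simp only [waveOp, Finset.mul_sum, mul_zero] at this
    rw [← this]
    exact Finset.sum_congr rfl fun μ _ => by simp only [smul_eq_mul]; ring
  simp only [this, intervalIntegral.integral_zero]

end WaveOperator

section Euler

variable {φ : (Fin 4 → ℝ) → ℝ}

/-- The Euler (dilation) operator `x^ρ ∂_ρ`. -/
noncomputable def euler (φ : (Fin 4 → ℝ) → ℝ) (x : Fin 4 → ℝ) : ℝ :=
  ∑ ρ, x ρ * pd ρ φ x

lemma contDiff_euler (hφ : ContDiff ℝ ∞ φ) : ContDiff ℝ ∞ (euler φ) :=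
  ContDiff.sum fun ρ _ => (contDiff_coord ρ).mul (contDiff_pd ρ hφ)

lemma pd_euler (μ : Fin 4) (hφ : ContDiff ℝ ∞ φ) :
    pd μ (euler φ) = fun x => pd μ φ x + euler (pd μ φ) x := by
  ext x
  unfold euler
  rw [pd_sum μ fun ρ => (contDiff_coord ρ).mul (contDiff_pd ρ hφ)]
  simp only [pd_mul _ (contDiff_coord _) (contDiff_pd _ hφ), pd_coord, Finset.sum_add_distrib,
    pd_comm μ _ hφ]
  simp [add_comm]

lemma waveOp_euler (hφ : ContDiff ℝ ∞ φ) (hw : ∀ x, waveOp φ x = 0) (x : Fin 4 → ℝ) :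
    waveOp (euler φ) x = 0 := by
  unfold euler
  rw [waveOp_sum fun ρ => (contDiff_coord ρ).mul (contDiff_pd ρ hφ)]
  simp only [waveOp_mul (contDiff_coord _) (contDiff_pd _ hφ), waveOp_coord,
    waveOp_pd_eq_zero _ hφ hw, pd_coord]
  simp only [mul_zero, add_zero, zero_add, ite_mul, one_mul, zero_mul, mul_ite,
    Finset.sum_ite_eq, Finset.mem_univ, if_true, ← Finset.mul_sum]
  have := hw x
  rw [waveOp] at this
  rw [this, mul_zero]

lemma euler_radialIntegral_add (k : ℕ) (hφ : ContDiff ℝ ∞ φ) (x : Fin 4 → ℝ) :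
    euler (radialIntegral k φ) x + (k + 1) * radialIntegral k φ x = φ x := by
  have hc := hφ.continuous
  have hc' (μ : Fin 4) : Continuous (pd μ φ) := (contDiff_pd μ hφ).continuous
  have hder (s : ℝ) : HasDerivAt (fun s : ℝ => s ^ (k + 1) * φ (s • x))
      ((∑ ρ, x ρ * s ^ (k + 1) • pd ρ φ (s • x)) + (k + 1) * s ^ k • φ (s • x)) s := by
    have h1 : HasDerivAt (fun s : ℝ => φ (s • x)) (fderiv ℝ φ (s • x) x) s := by
      have h2 : HasDerivAt (fun s : ℝ => s • x) x s := by
        simpa using (hasDerivAt_id s).smul_const x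
      exact (hφ.differentiable (by simp) (s • x)).hasFDerivAt.comp_hasDerivAt s h2
    have h3 : fderiv ℝ φ (s • x) x = ∑ ρ, x ρ * pd ρ φ (s • x) := by
      conv_lhs => enter [2]; rw [pi_eq_sum_univ' x]
      simp [pd, map_sum]
    refine ((hasDerivAt_pow (k + 1) s).mul h1).congr_deriv ?_
    rw [h3, Finset.mul_sum, add_comm]
    simp only [smul_eq_mul, Nat.add_sub_cancel]
    push_cast
    congr 1
    · exact Finset.sum_congr rfl fun ρ _ => by ring
    · ring
  have hint := intervalIntegral.integral_eq_sub_of_hasDerivAt (a := 0) (b := 1)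
    (fun s _ => hder s) (Continuous.intervalIntegrable (by fun_prop) _ _)
  rw [intervalIntegral.integral_add (Continuous.intervalIntegrable (by fun_prop) _ _)
    (Continuous.intervalIntegrable (by fun_prop) _ _), intervalIntegral.integral_finsetSum
    fun μ _ => Continuous.intervalIntegrable (by fun_prop) _ _] at hint
  simp only [intervalIntegral.integral_const_mul] at hint
  simp only [euler, pd_radialIntegral _ _ hφ]
  simpa [radialIntegral] using hint

end Euler

section Conformal

variable {φ : (Fin 4 → ℝ) → ℝ}

/-- The Minkowski square `η_{ρρ} (x^ρ)²`. -/
def minkSq (x : Fin 4 → ℝ) : ℝ :=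
  ∑ ρ, minkEta ρ ρ * (x ρ * x ρ)

lemma minkEta_mul_self (μ : Fin 4) : minkEta μ μ * minkEta μ μ = 1 := by
  unfold minkEta
  split_ifs <;> simp_all

lemma contDiff_minkSq : ContDiff ℝ ∞ minkSq :=
  ContDiff.sum fun ρ _ => contDiff_const.mul ((contDiff_coord ρ).mul (contDiff_coord ρ))

lemma pd_minkSq (μ : Fin 4) : pd μ minkSq = fun x => 2 * minkEta μ μ * x μ := by
  have h (ρ : Fin 4) : ContDiff ℝ ∞ fun x : Fin 4 → ℝ => x ρ * x ρ :=
    (contDiff_coord ρ).mul (contDiff_coord ρ)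
  ext x
  unfold minkSq
  rw [pd_sum μ fun ρ => contDiff_const.mul (h ρ)]
  simp only [pd_const_mul _ _ (h _), pd_mul _ (contDiff_coord _) (contDiff_coord _), pd_coord]
  simp only [mul_ite, mul_one, mul_zero, ← two_mul, Finset.sum_ite_eq', Finset.mem_univ, if_true]
  ring

lemma waveOp_minkSq (x : Fin 4 → ℝ) : waveOp minkSq x = 8 := by
  simp only [waveOp, pd_minkSq, pd_const_mul _ _ (contDiff_coord _), pd_coord]
  simp only [if_true, mul_one, mul_left_comm _ (2 : ℝ), minkEta_mul_self]
  norm_num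

/-- The generator `2 x_μ (x·∂ + 1) - x² ∂_μ` of special conformal transformations, acting on
scalar fields of scaling dimension `1`. -/
noncomputable def conformalGenerator (μ : Fin 4) (φ : (Fin 4 → ℝ) → ℝ) (x : Fin 4 → ℝ) : ℝ :=
  2 * minkEta μ μ * (x μ * (euler φ x + φ x)) - minkSq x * pd μ φ x

lemma contDiff_conformalGenerator (μ : Fin 4) (hφ : ContDiff ℝ ∞ φ) :
    ContDiff ℝ ∞ (conformalGenerator μ φ) :=
  (contDiff_const.mul ((contDiff_coord μ).mul ((contDiff_euler hφ).add hφ))).sub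
    (contDiff_minkSq.mul (contDiff_pd μ hφ))

lemma waveOp_conformalGenerator (μ : Fin 4) (hφ : ContDiff ℝ ∞ φ) (hw : ∀ x, waveOp φ x = 0)
    (x : Fin 4 → ℝ) : waveOp (conformalGenerator μ φ) x = 0 := by
  have hE := (contDiff_euler hφ).add hφ
  have hpd := contDiff_pd μ hφ
  have hx := (contDiff_coord μ).mul hE
  unfold conformalGenerator
  rw [waveOp_sub (contDiff_const.mul hx) (contDiff_minkSq.mul hpd), waveOp_const_mul _ hx,
    waveOp_mul (contDiff_coord μ) hE, waveOp_add (contDiff_euler hφ) hφ, waveOp_euler hφ hw, hw,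
    waveOp_coord, waveOp_mul contDiff_minkSq hpd, waveOp_minkSq, waveOp_pd_eq_zero μ hφ hw]
  simp only [pd_coord, pd_minkSq, pd_add _ (contDiff_euler hφ) hφ, pd_euler _ hφ]
  have h1 : ∑ ρ, minkEta ρ ρ * (2 * minkEta ρ ρ * x ρ * pd ρ (pd μ φ) x) =
      2 * euler (pd μ φ) x := by
    rw [euler, Finset.mul_sum]
    refine Finset.sum_congr rfl fun ρ _ => ?_
    linear_combination 2 * x ρ * pd ρ (pd μ φ) x * minkEta_mul_self ρ
  rw [h1]
  simp only [ite_mul, one_mul, zero_mul, mul_ite, mul_zero, Finset.sum_ite_eq, Finset.mem_univ,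
    if_true]
  linear_combination 4 * (2 * pd μ φ x + euler (pd μ φ) x) * minkEta_mul_self μ

lemma div_conformalGenerator (hφ : ContDiff ℝ ∞ φ) (hw : ∀ x, waveOp φ x = 0) (x : Fin 4 → ℝ) :
    ∑ μ, minkEta μ μ * pd μ (conformalGenerator μ φ) x =
      2 * euler (euler φ) x + 8 * euler φ x + 8 * φ x := by
  have hE := contDiff_euler hφ
  have hEφ := hE.add hφ
  have hx (μ : Fin 4) := (contDiff_coord μ).mul hEφ
  have h (μ : Fin 4) : minkEta μ μ * pd μ (conformalGenerator μ φ) x =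
      2 * (x μ * pd μ (euler φ) x) + 2 * (euler φ x + φ x)
        - minkSq x * (minkEta μ μ * pd μ (pd μ φ) x) := by
    unfold conformalGenerator
    rw [pd_sub _ (contDiff_const.mul (hx μ)) (contDiff_minkSq.mul (contDiff_pd μ hφ)),
      pd_const_mul _ _ (hx μ), pd_mul _ (contDiff_coord μ) hEφ,
      pd_mul _ contDiff_minkSq (contDiff_pd μ hφ), pd_add _ hE hφ, pd_coord, pd_minkSq]
    simp only [if_true]
    linear_combination (2 * (x μ * pd μ (euler φ) x) + 2 * (euler φ x + φ x)) * minkEta_mul_self μ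
  have hw' : ∑ μ, minkEta μ μ * pd μ (pd μ φ) x = 0 := hw x
  simp only [h, Finset.sum_sub_distrib, Finset.sum_add_distrib, ← Finset.mul_sum, hw']
  simp only [euler, Finset.sum_const, Finset.card_univ, Fintype.card_fin, nsmul_eq_mul]
  push_cast
  ring

end Conformal

section Divergence

variable {φ : (Fin 4 → ℝ) → ℝ}

/-- A vector potential whose divergence is `φ` and whose components solve the wave equation
whenever `φ` does. -/
noncomputable def wavePotential (φ : (Fin 4 → ℝ) → ℝ) (μ : Fin 4) (x : Fin 4 → ℝ) : ℝ :=
  (1 / 2) * conformalGenerator μ (radialIntegral 1 (radialIntegral 1 φ)) x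

lemma contDiff_wavePotential (hφ : ContDiff ℝ ∞ φ) (μ : Fin 4) :
    ContDiff ℝ ∞ (wavePotential φ μ) :=
  contDiff_const.mul (contDiff_conformalGenerator μ
    (contDiff_radialIntegral 1 (contDiff_radialIntegral 1 hφ)))

lemma waveOp_wavePotential (hφ : ContDiff ℝ ∞ φ) (hw : ∀ x, waveOp φ x = 0) (μ : Fin 4)
    (x : Fin 4 → ℝ) : waveOp (wavePotential φ μ) x = 0 := by
  have h1 := contDiff_radialIntegral 1 hφ
  have h2 := contDiff_radialIntegral 1 h1
  unfold wavePotential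
  rw [waveOp_const_mul _ (contDiff_conformalGenerator μ h2), waveOp_conformalGenerator μ h2
    (waveOp_radialIntegral 1 h1 (waveOp_radialIntegral 1 hφ hw)), mul_zero]

lemma div_wavePotential (hφ : ContDiff ℝ ∞ φ) (hw : ∀ x, waveOp φ x = 0) (x : Fin 4 → ℝ) :
    ∑ μ, minkEta μ μ * pd μ (wavePotential φ μ) x = φ x := by
  have h1 := contDiff_radialIntegral 1 hφ
  have h2 := contDiff_radialIntegral 1 h1
  have hdiv := div_conformalGenerator h2
    (waveOp_radialIntegral 1 h1 (waveOp_radialIntegral 1 hφ hw)) x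
  have e1 := euler_radialIntegral_add 1 hφ x
  have e2 := euler_radialIntegral_add 1 h1 x
  have e3 : euler (radialIntegral 1 φ) x =
      euler (euler (radialIntegral 1 (radialIntegral 1 φ))) x +
        2 * euler (radialIntegral 1 (radialIntegral 1 φ)) x := by
    have h : radialIntegral 1 φ = fun x => euler (radialIntegral 1 (radialIntegral 1 φ)) x +
        2 * radialIntegral 1 (radialIntegral 1 φ) x := by
      ext y
      have := euler_radialIntegral_add 1 h1 y
      push_cast at this
      linear_combination -this
    conv_lhs => rw [h]
    simp only [euler.eq_1 (fun x => _ + _), pd_add _ (contDiff_euler h2) (contDiff_const.mul h2),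
      pd_const_mul _ _ h2, mul_add, Finset.sum_add_distrib]
    simp only [euler.eq_1 _ x, Finset.mul_sum, mul_left_comm _ (2 : ℝ)]
  have h (μ : Fin 4) : minkEta μ μ * pd μ (wavePotential φ μ) x = (1 / 2) * (minkEta μ μ *
      pd μ (conformalGenerator μ (radialIntegral 1 (radialIntegral 1 φ))) x) := by
    unfold wavePotential
    rw [pd_const_mul _ _ (contDiff_conformalGenerator μ h2)]
    ring
  simp only [h, ← Finset.mul_sum, hdiv]
  push_cast at e1 e2
  linear_combination e1 + 2 * e2 - e3

lemma div_symmetrized_gradient {v : Fin 4 → (Fin 4 → ℝ) → ℝ} (hv : ∀ ν, ContDiff ℝ ∞ (v ν))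
    (hw : ∀ ν x, waveOp (v ν) x = 0) (μ : Fin 4) (x : Fin 4 → ℝ) :
    ∑ ν, minkEta ν ν * pd ν (fun y => (1 / 2) * (pd μ (v ν) y + pd ν (v μ) y)) x =
      (1 / 2) * pd μ (fun y => ∑ ν, minkEta ν ν * pd ν (v ν) y) x := by
  have hd (μ ν : Fin 4) : ContDiff ℝ ∞ (pd μ (v ν)) := contDiff_pd μ (hv ν)
  have hw' : ∑ ν, minkEta ν ν * pd ν (pd ν (v μ)) x = 0 := hw μ x
  rw [pd_sum μ fun ν => contDiff_const.mul (hd ν ν), ← add_zero (_ * _),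
    ← mul_zero (1 / 2 : ℝ), ← hw', ← mul_add, ← Finset.sum_add_distrib, Finset.mul_sum]
  refine Finset.sum_congr rfl fun ν _ => ?_
  rw [pd_const_mul _ _ ((hd μ ν).add (hd ν μ)), pd_add _ (hd μ ν) (hd ν μ),
    pd_const_mul _ _ (hd ν ν), pd_comm μ ν (hv ν)]
  ring

lemma div_sub_symmetrized_gradient {h v : Fin 4 → (Fin 4 → ℝ) → ℝ}
    (hh : ∀ ν, ContDiff ℝ ∞ (h ν)) (hv : ∀ ν, ContDiff ℝ ∞ (v ν))
    (hw : ∀ ν x, waveOp (v ν) x = 0) (μ : Fin 4) (x : Fin 4 → ℝ) :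
    ∑ ν, minkEta ν ν * pd ν (fun y => h ν y - (1 / 2) * (pd μ (v ν) y + pd ν (v μ) y)) x =
      ∑ ν, minkEta ν ν * pd ν (h ν) x -
        (1 / 2) * pd μ (fun y => ∑ ν, minkEta ν ν * pd ν (v ν) y) x := by
  have hs (ν : Fin 4) : ContDiff ℝ ∞ fun y => (1 / 2) * (pd μ (v ν) y + pd ν (v μ) y) :=
    contDiff_const.mul ((contDiff_pd μ (hv ν)).add (contDiff_pd ν (hv μ)))
  rw [← div_symmetrized_gradient hv hw]
  simp only [pd_sub _ (hh _) (hs _), mul_sub, Finset.sum_sub_distrib]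

lemma trace_sub_symmetrized_gradient (t : Fin 4 → ℝ) (v : Fin 4 → (Fin 4 → ℝ) → ℝ)
    (x : Fin 4 → ℝ) :
    ∑ μ, minkEta μ μ * (t μ - (1 / 2) * (pd μ (v μ) x + pd μ (v μ) x)) =
      ∑ μ, minkEta μ μ * t μ - ∑ μ, minkEta μ μ * pd μ (v μ) x := by
  rw [← Finset.sum_sub_distrib]
  exact Finset.sum_congr rfl fun μ _ => by ring

/-- The trace reversal `b_{μν} - ½ η_{μν} b` of `b`. -/
noncomputable def traceReverse (b : Fin 4 → Fin 4 → (Fin 4 → ℝ) → ℝ) (μ ν : Fin 4)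
    (x : Fin 4 → ℝ) : ℝ :=
  b μ ν x - (1 / 2 * minkEta μ ν) * ∑ ρ, minkEta ρ ρ * b ρ ρ x

variable {b : Fin 4 → Fin 4 → (Fin 4 → ℝ) → ℝ}

lemma contDiff_trace (hb : ∀ μ ν, ContDiff ℝ ∞ (b μ ν)) :
    ContDiff ℝ ∞ fun x => ∑ ρ, minkEta ρ ρ * b ρ ρ x :=
  ContDiff.sum fun ρ _ => contDiff_const.mul (hb ρ ρ)

lemma waveOp_trace (hb : ∀ μ ν, ContDiff ℝ ∞ (b μ ν)) (hw : ∀ μ ν x, waveOp (b μ ν) x = 0)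
    (x : Fin 4 → ℝ) : waveOp (fun x => ∑ ρ, minkEta ρ ρ * b ρ ρ x) x = 0 := by
  rw [waveOp_sum fun ρ => contDiff_const.mul (hb ρ ρ)]
  simp [waveOp_const_mul _ (hb _ _), hw]

lemma contDiff_traceReverse (hb : ∀ μ ν, ContDiff ℝ ∞ (b μ ν)) (μ ν : Fin 4) :
    ContDiff ℝ ∞ (traceReverse b μ ν) :=
  (hb μ ν).sub (contDiff_const.mul (contDiff_trace hb))

lemma waveOp_traceReverse (hb : ∀ μ ν, ContDiff ℝ ∞ (b μ ν))
    (hw : ∀ μ ν x, waveOp (b μ ν) x = 0) (μ ν : Fin 4) (x : Fin 4 → ℝ) :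
    waveOp (traceReverse b μ ν) x = 0 := by
  unfold traceReverse
  rw [waveOp_sub (hb μ ν) (contDiff_const.mul (contDiff_trace hb)),
    waveOp_const_mul _ (contDiff_trace hb), waveOp_trace hb hw, hw, mul_zero, sub_zero]

lemma trace_traceReverse (b : Fin 4 → Fin 4 → (Fin 4 → ℝ) → ℝ) (x : Fin 4 → ℝ) :
    ∑ ρ, minkEta ρ ρ * traceReverse b ρ ρ x = (-1) * ∑ ρ, minkEta ρ ρ * b ρ ρ x := by
  have h (ρ : Fin 4) : minkEta ρ ρ * traceReverse b ρ ρ x =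
      minkEta ρ ρ * b ρ ρ x - 1 / 2 * ∑ ρ, minkEta ρ ρ * b ρ ρ x := by
    rw [traceReverse]
    linear_combination (-1 / 2 * ∑ ρ, minkEta ρ ρ * b ρ ρ x) * minkEta_mul_self ρ
  simp only [h, Finset.sum_sub_distrib, Finset.sum_const, Finset.card_univ, Fintype.card_fin,
    nsmul_eq_mul]
  push_cast
  ring

lemma div_traceReverse (hb : ∀ μ ν, ContDiff ℝ ∞ (b μ ν)) (μ : Fin 4) (x : Fin 4 → ℝ) :
    ∑ ν, minkEta ν ν * pd ν (traceReverse b μ ν) x -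
        (1 / 2) * pd μ (fun y => ∑ ρ, minkEta ρ ρ * traceReverse b ρ ρ y) x =
      ∑ ν, minkEta ν ν * pd ν (b μ ν) x := by
  have ht := contDiff_trace hb
  have hη (ν : Fin 4) (c : ℝ) : minkEta ν ν * (1 / 2 * minkEta μ ν * c) =
      if μ = ν then 1 / 2 * c else 0 := by
    split_ifs with h
    · subst h
      linear_combination 1 / 2 * c * minkEta_mul_self μ
    · simp [minkEta, h]
  rw [funext (trace_traceReverse b), pd_const_mul _ _ ht]
  unfold traceReverse
  simp only [pd_sub _ (hb _ _) (contDiff_const.mul ht), pd_const_mul _ _ ht, mul_sub, hη,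
    Finset.sum_sub_distrib, Finset.sum_ite_eq, Finset.mem_univ, if_true]
  ring

end Divergence

/-- In `ker Q / ran Q` in the one-particle sector of the massless graviton Fock space,
every class — given by a kernel pair `(f_{μν}, g_μ)` with `f` symmetric and
`∂^ν f_{μν} = ½ ∂_μ f` — has a representative with `g = 0`, `∂^ν f_{μν} = 0` and `f = 0`,
obtained by adding an image pair `(−½(∂_μ g′_ν + ∂_ν g′_μ), ∂^ν g′_{μν} − ½ ∂_μ g′)`;
the residual freedom is `f_{μν} ↦ f_{μν} − ½(∂_μ g″_ν + ∂_ν g″_μ)` with `∂^μ g″_μ = 0`. -/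
theorem stmt19 (f : Fin 4 → Fin 4 → ((Fin 4 → ℝ) → ℝ))
    (g : Fin 4 → ((Fin 4 → ℝ) → ℝ))
    (hfsmooth : ∀ μ ν, ContDiff ℝ (⊤ : ℕ∞) (f μ ν))
    (hgsmooth : ∀ μ, ContDiff ℝ (⊤ : ℕ∞) (g μ))
    (hsym : ∀ μ ν, f μ ν = f ν μ)
    (hwavef : ∀ μ ν x, waveOp (f μ ν) x = 0)
    (hwaveg : ∀ μ x, waveOp (g μ) x = 0)
    (hker : ∀ μ x, (∑ ν : Fin 4, minkEta ν ν * pd ν (f μ ν) x)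
      = (1/2) * pd μ (fun y => ∑ ρ : Fin 4, minkEta ρ ρ * f ρ ρ y) x) :
    ∃ (gv : Fin 4 → ((Fin 4 → ℝ) → ℝ)) (gt : Fin 4 → Fin 4 → ((Fin 4 → ℝ) → ℝ)),
      (∀ μ, ContDiff ℝ (⊤ : ℕ∞) (gv μ)) ∧ (∀ μ ν, ContDiff ℝ (⊤ : ℕ∞) (gt μ ν)) ∧
      (∀ μ x, waveOp (gv μ) x = 0) ∧ (∀ μ ν x, waveOp (gt μ ν) x = 0) ∧
      -- the g-component of the new representative vanishes
      (∀ μ x, g μ x + ((∑ ν : Fin 4, minkEta ν ν * pd ν (gt μ ν) x)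
        - (1/2) * pd μ (fun y => ∑ ρ : Fin 4, minkEta ρ ρ * gt ρ ρ y) x) = 0) ∧
      -- the new f-component is transverse
      (∀ μ x, (∑ ν : Fin 4, minkEta ν ν *
        pd ν (fun y => f μ ν y - (1/2) * (pd μ (gv ν) y + pd ν (gv μ) y)) x) = 0) ∧
      -- and traceless
      (∀ x, (∑ μ : Fin 4, minkEta μ μ *
        (f μ μ x - (1/2) * (pd μ (gv μ) x + pd μ (gv μ) x))) = 0) ∧
      -- residual freedom: divergence-free gauge vectors preserve both conditions
      (∀ gres : Fin 4 → ((Fin 4 → ℝ) → ℝ),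
        (∀ μ, ContDiff ℝ (⊤ : ℕ∞) (gres μ)) → (∀ μ x, waveOp (gres μ) x = 0) →
        (∀ x, (∑ μ : Fin 4, minkEta μ μ * pd μ (gres μ) x) = 0) →
        (∀ μ x, (∑ ν : Fin 4, minkEta ν ν *
          pd ν (fun y => (f μ ν y - (1/2) * (pd μ (gv ν) y + pd ν (gv μ) y))
            - (1/2) * (pd μ (gres ν) y + pd ν (gres μ) y)) x) = 0) ∧
        (∀ x, (∑ μ : Fin 4, minkEta μ μ *
          ((f μ μ x - (1/2) * (pd μ (gv μ) x + pd μ (gv μ) x))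
            - (1/2) * (pd μ (gres μ) x + pd μ (gres μ) x))) = 0)) := by
  have hF := contDiff_trace hfsmooth
  have hwF := waveOp_trace hfsmooth hwavef
  have hv := contDiff_wavePotential hF
  have hwv := waveOp_wavePotential hF hwF
  have hdivv := div_wavePotential hF hwF
  have hneg (μ : Fin 4) : ContDiff ℝ (⊤ : ℕ∞) fun x => -1 * g μ x :=
    contDiff_const.mul (hgsmooth μ)
  have hwneg (μ : Fin 4) (x : Fin 4 → ℝ) : waveOp (fun x => -1 * g μ x) x = 0 := by
    rw [waveOp_const_mul _ (hgsmooth μ), hwaveg, mul_zero]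
  have hb (μ : Fin 4) := contDiff_wavePotential (hneg μ)
  have hwb (μ : Fin 4) := waveOp_wavePotential (hneg μ) (hwneg μ)
  have htransverse (μ : Fin 4) (x : Fin 4 → ℝ) := by
    have := div_sub_symmetrized_gradient (hfsmooth μ) hv hwv μ x
    rwa [hker, funext hdivv, sub_self] at this
  have htrace (x : Fin 4 → ℝ) := by
    have := trace_sub_symmetrized_gradient (fun μ => f μ μ x)
      (wavePotential fun x => ∑ ρ, minkEta ρ ρ * f ρ ρ x) x
    rwa [hdivv, sub_self] at this
  refine ⟨wavePotential fun x => ∑ ρ, minkEta ρ ρ * f ρ ρ x,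
    traceReverse fun μ => wavePotential fun x => -1 * g μ x, hv, contDiff_traceReverse hb, hwv,
    waveOp_traceReverse hb hwb, fun μ x => ?_, htransverse, htrace,
    fun gres hres hwres hdiv => ⟨fun μ x => ?_, fun x => ?_⟩⟩
  · rw [div_traceReverse hb, div_wavePotential (hneg μ) (hwneg μ)]
    ring
  · rw [div_sub_symmetrized_gradient (fun ν => (hfsmooth μ ν).sub (contDiff_const.mul
      ((contDiff_pd μ (hv ν)).add (contDiff_pd ν (hv μ))))) hres hwres, htransverse,
      funext hdiv, pd_const]
    ring
  · rw [trace_sub_symmetrized_gradient, htrace, hdiv, sub_zero]
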